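/- There exists a weak solution of X_t = ∫_0^t α_s ds + B_t with a closed-loop control (α progressively measurable with respect to the augmented natural filtration of X), namely the weak solution of Tsirelson's SDE with α_t := μ(t, X_·), for which (B, X) ∈ D P-a.s.; consequently the closed-loop value satisfies V^c_0 = 1 (the upper bound V^c_0 ≤ 1 holding since g = 1_D ≤ 1). -/

import Mathlib

open MeasureTheory ProbabilityTheory Filter Set Matrix
open scoped Classical

noncomputable section

/-- The σ-algebra generated by the `P`-null sets. -/
def nullSets {Ω : Type*} [MeasurableSpace Ω] (P : Measure Ω) : MeasurableSpace Ω :=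
  MeasurableSpace.generateFrom {s : Set Ω | P s = 0}

/-- The natural filtration of a process `u`. -/
def natFilt {Ω E : Type*} [MeasurableSpace E] (u : ℝ → Ω → E) (s : ℝ) :
    MeasurableSpace Ω :=
  ⨆ r ∈ Set.Icc (0 : ℝ) s, MeasurableSpace.comap (u r) inferInstance

/-- The `P`-augmented natural filtration of a process `u`. -/
def augFilt {Ω E : Type*} [MeasurableSpace Ω] [MeasurableSpace E] (P : Measure Ω)
    (u : ℝ → Ω → E) (s : ℝ) : MeasurableSpace Ω :=
  natFilt u s ⊔ nullSets P

/-- Progressive measurability of a process `u` with respect to a family of σ-algebras `F`. -/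
def ProgMeas {Ω E : Type*} [MeasurableSpace E] (F : ℝ → MeasurableSpace Ω)
    (u : ℝ → Ω → E) : Prop :=
  ∀ s : ℝ, 0 ≤ s →
    @Measurable (Set.Icc (0 : ℝ) s × Ω) E
      (MeasurableSpace.prod inferInstance (F s)) _ (fun p => u p.1 p.2)

/-- Tsirelson's drift, relative to the time sequence `t : ℤ → ℝ`:
`μ(s, x) = fract ((x (t k) - x (t (k-1))) / (t k - t (k-1)))` for `s ∈ [t k, t (k+1))`,
`k ≤ -1`, and `0` otherwise. -/
def tsirelsonDrift (t : ℤ → ℝ) (s : ℝ) (x : ℝ → ℝ) : ℝ :=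
  if h : ∃ k : ℤ, k ≤ -1 ∧ t k ≤ s ∧ s < t (k + 1) then
    Int.fract ((x (t h.choose) - x (t (h.choose - 1))) / (t h.choose - t (h.choose - 1)))
  else 0

/-- The hypotheses on the time sequence: `t 0 = T`, strictly increasing, and
`t k ↓ 0` as `k → -∞`. -/
def TsirelsonTimes (T : ℝ) (t : ℤ → ℝ) : Prop :=
  t 0 = T ∧ (∀ k : ℤ, k ≤ 0 → t (k - 1) < t k) ∧
    Tendsto (fun n : ℕ => t (-(n : ℤ))) atTop (nhds 0)

/-- `B` is a one-dimensional `F`-Brownian motion under `P`: continuous paths started at `0`,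
adapted, with increments that are centered Gaussian and independent of the past. -/
def IsBM {Ω : Type*} [MeasurableSpace Ω] (P : Measure Ω) (F : ℝ → MeasurableSpace Ω)
    (B : ℝ → Ω → ℝ) : Prop :=
  (∀ ω, B 0 ω = 0) ∧ (∀ ω, Continuous fun s => B s ω) ∧
  (∀ s : ℝ, 0 ≤ s → Measurable[F s] (B s)) ∧
  (∀ s u : ℝ, 0 ≤ s → s < u →
    Measure.map (fun ω => B u ω - B s ω) P = gaussianReal 0 ((u - s).toNNReal) ∧
    Indep (MeasurableSpace.comap (fun ω => B u ω - B s ω) inferInstance) (F s) P)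

/-- The process `α*` from the counterexample: a clamped pathwise left derivative of the
difference of the two coordinate paths,
`α*(s, (w, x)) = 0 ∨ [limsup_{h→0} ((x-w)_s - (x-w)_{(s-h)⁺})/h] ∧ 1`. -/
def alphaStar (s : ℝ) (w x : ℝ → ℝ) : ℝ :=
  max 0 (min 1 (Filter.limsup
    (fun h : ℝ => ((x s - w s) - (x (max (s - h) 0) - w (max (s - h) 0))) / h)
    (nhdsWithin 0 (Set.Ioi 0))))

/-- The set `D` of pairs of paths `(w, x)` with `∫_0^T |α*(s,(w,x)) - μ(s,x)| ds = 0`. -/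
def tsirelsonSetD (T : ℝ) (t : ℤ → ℝ) : Set ((ℝ → ℝ) × (ℝ → ℝ)) :=
  {p | (∫ s in Set.Icc (0 : ℝ) T, |alphaStar s p.1 p.2 - tsirelsonDrift t s p.2|) = 0}

/-- A weak solution of the controlled SDE `X_s = ∫_0^s α_r dr + B_s` on `[0, T]`,
with control valued in `A = [0, 1]`. -/
structure ControlWeakSol (T : ℝ) where
  Ω : Type
  mΩ : MeasurableSpace Ω
  P : @Measure Ω mΩ
  hP : IsProbabilityMeasure P
  F : ℝ → MeasurableSpace Ω
  F_mono : ∀ s u : ℝ, s ≤ u → F s ≤ F u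
  F_le : ∀ s : ℝ, F s ≤ mΩ
  B : ℝ → Ω → ℝ
  X : ℝ → Ω → ℝ
  α : ℝ → Ω → ℝ
  hB : @IsBM Ω mΩ P F B
  α_prog : ProgMeas F α
  α_mem : ∀ s ω, α s ω ∈ Set.Icc (0 : ℝ) 1
  X_cont : ∀ ω, Continuous fun s => X s ω
  X_prog : ProgMeas F X
  sde : ∀ᵐ ω ∂P, ∀ s ∈ Set.Icc (0 : ℝ) T,
    X s ω = (∫ r in Set.Icc (0 : ℝ) s, α r ω) + B s ω

attribute [instance] ControlWeakSol.mΩ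

/-- Open-loop: the control is prog. measurable w.r.t. the `P`-augmented natural filtration
of `B`. -/
def ControlWeakSol.OpenLoop {T : ℝ} (S : ControlWeakSol T) : Prop :=
  ProgMeas (augFilt S.P S.B) S.α

/-- Closed-loop: the control is prog. measurable w.r.t. the `P`-augmented natural filtration
of `X`. -/
def ControlWeakSol.ClosedLoop {T : ℝ} (S : ControlWeakSol T) : Prop :=
  ProgMeas (augFilt S.P S.X) S.α

/-- The payoff `E^P[1_D(B, X)] = P((B, X) ∈ D)`. -/
def ControlWeakSol.payoff {T : ℝ} (t : ℤ → ℝ) (S : ControlWeakSol T) : ℝ :=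
  (S.P {ω | ((fun s => S.B s ω), (fun s => S.X s ω)) ∈ tsirelsonSetD T t}).toReal

/-- The open-loop value `V^o_0`. -/
def VopenD (T : ℝ) (t : ℤ → ℝ) : ℝ :=
  sSup {r | ∃ S : ControlWeakSol T, S.OpenLoop ∧ r = S.payoff t}

/-- The closed-loop value `V^c_0`. -/
def VclosedD (T : ℝ) (t : ℤ → ℝ) : ℝ :=
  sSup {r | ∃ S : ControlWeakSol T, S.ClosedLoop ∧ r = S.payoff t}

/-- The identity clamped to the unit interval. -/
def unitClamp (x : ℝ) : ℝ := max 0 (min x 1)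

/-- The tent of height `1 / 2` over the unit interval. -/
def unitTent (x : ℝ) : ℝ := max 0 (min x (1 - x))

lemma continuous_unitTent : Continuous unitTent := by
  unfold unitTent; fun_prop

lemma unitTent_nonneg (x : ℝ) : 0 ≤ unitTent x := le_max_left _ _

lemma unitClamp_nonneg (x : ℝ) : 0 ≤ unitClamp x := le_max_left _ _

lemma unitClamp_le_one (x : ℝ) : unitClamp x ≤ 1 := by
  unfold unitClamp; grind

lemma unitClamp_mono {x y : ℝ} (h : x ≤ y) : unitClamp x ≤ unitClamp y := by
  unfold unitClamp; grind

lemma unitTent_le_sub (x : ℝ) : unitTent x ≤ unitClamp x - unitClamp (x - 1) := by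
  unfold unitTent unitClamp; grind

lemma unitClamp_mul_one_sub_le (x : ℝ) :
    unitClamp x * (1 - unitClamp x) ≤ unitClamp x - unitClamp (x - 1) := by
  have h0 := unitClamp_nonneg x
  have h1 := unitClamp_le_one x
  rcases le_total x 1 with h | h
  · have : unitClamp (x - 1) = 0 := by unfold unitClamp; grind
    nlinarith
  · have : unitClamp x = 1 := by unfold unitClamp; grind
    have := unitClamp_le_one (x - 1)
    simp_all

lemma unitTent_eq (x : ℝ) : unitTent x = (unitClamp (2 * x) - unitClamp (2 * x - 1)) / 2 := by
  unfold unitTent unitClamp; grind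

lemma unitClamp_eq (x : ℝ) : unitClamp x = (unitClamp (2 * x) + unitClamp (2 * x - 1)) / 2 := by
  unfold unitClamp; grind

lemma sum_unitClamp_sub_le_one (x : ℝ) (n : ℕ) :
    ∑ k ∈ Finset.range n, (unitClamp (x - k) - unitClamp (x - k - 1)) ≤ 1 := by
  have h := Finset.sum_range_sub' (fun k : ℕ => unitClamp (x - k)) n
  have h' : ∑ k ∈ Finset.range n, (unitClamp (x - k) - unitClamp (x - k - 1)) =
      unitClamp (x - (0 : ℕ)) - unitClamp (x - n) := by
    rw [← h]
    refine Finset.sum_congr rfl fun k _ => ?_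
    push_cast
    ring_nf
  rw [h']
  linarith [unitClamp_le_one (x - (0 : ℕ)), unitClamp_nonneg (x - n)]

lemma sum_unitTent_le_one (x : ℝ) (n : ℕ) :
    ∑ k ∈ Finset.range n, unitTent (x - k) ≤ 1 :=
  (Finset.sum_le_sum fun _ _ => unitTent_le_sub _).trans (sum_unitClamp_sub_le_one x n)

lemma sum_unitClamp (x : ℝ) (hx : 0 ≤ x) (n : ℕ) :
    ∑ k ∈ Finset.range n, unitClamp (x - k) = min x n := by
  induction n with
  | zero => simp [hx]
  | succ n ih =>
    rw [Finset.sum_range_succ, ih]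
    unfold unitClamp
    push_cast
    have : (0 : ℝ) ≤ n := n.cast_nonneg
    grind

lemma abs_sum_unitClamp_mul_sub_le {x y : ℝ} (hx : 0 ≤ x) (hxy : x ≤ y) {n : ℕ} (hxn : x ≤ n) :
    |∑ k ∈ Finset.range n, unitClamp (x - k) * unitClamp (y - k) - x| ≤ 1 := by
  have h1 : ∑ k ∈ Finset.range n, unitClamp (x - k) = x := by
    rw [sum_unitClamp x hx, min_eq_left hxn]
  have h2 : x - ∑ k ∈ Finset.range n, unitClamp (x - k) * unitClamp (y - k) =
      ∑ k ∈ Finset.range n, unitClamp (x - k) * (1 - unitClamp (y - k)) := by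
    conv_lhs => enter [1]; rw [← h1]
    rw [← Finset.sum_sub_distrib]
    exact Finset.sum_congr rfl fun _ _ => by ring
  rw [abs_sub_comm, h2, abs_of_nonneg]
  · refine (Finset.sum_le_sum fun k _ => ?_).trans (sum_unitClamp_sub_le_one x n)
    refine le_trans ?_ (unitClamp_mul_one_sub_le _)
    refine mul_le_mul_of_nonneg_left ?_ (unitClamp_nonneg _)
    have := unitClamp_mono (sub_le_sub_right hxy (k : ℝ))
    linarith
  · exact Finset.sum_nonneg fun k _ =>
      mul_nonneg (unitClamp_nonneg _) (by linarith [unitClamp_le_one (y - k)])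

lemma sum_range_two_mul (f : ℕ → ℝ) (n : ℕ) :
    ∑ k ∈ Finset.range (2 * n), f k = ∑ k ∈ Finset.range n, (f (2 * k) + f (2 * k + 1)) := by
  induction n with
  | zero => simp
  | succ n ih =>
    rw [mul_add, mul_one, Finset.sum_range_succ, Finset.sum_range_succ, ih,
      Finset.sum_range_succ, add_assoc]

/-- The Schauder covariances up to level `n`, in closed form. -/
lemma sum_unitTent_mul (u v : ℝ) (n : ℕ) :
    ∑ j ∈ Finset.range n, ∑ k ∈ Finset.range (2 ^ j),
        (1 / 2 : ℝ) ^ j * (unitTent (2 ^ j * u - k) * unitTent (2 ^ j * v - k)) =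
      (1 / 2 : ℝ) ^ n * ∑ k ∈ Finset.range (2 ^ n),
        unitClamp (2 ^ n * u - k) * unitClamp (2 ^ n * v - k) - unitClamp u * unitClamp v := by
  induction n with
  | zero => simp
  | succ n ih =>
    rw [Finset.sum_range_succ, ih, pow_succ' (2 : ℕ) n, pow_succ' (2 : ℝ) n, sum_range_two_mul, Finset.mul_sum,
      Finset.mul_sum, sub_add_eq_add_sub, ← Finset.sum_add_distrib]
    congr 1
    refine Finset.sum_congr rfl fun k _ => ?_
    rw [unitTent_eq, unitTent_eq, unitClamp_eq (2 ^ n * u - k), unitClamp_eq (2 ^ n * v - k)]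
    have e (w : ℝ) : 2 * (2 ^ n * w - k) = 2 * 2 ^ n * w - ((2 * k : ℕ) : ℝ) := by
      push_cast; ring
    have e' (w : ℝ) : 2 * (2 ^ n * w - k) - 1 = 2 * 2 ^ n * w - ((2 * k + 1 : ℕ) : ℝ) := by
      push_cast; ring
    rw [e' u, e' v, e u, e v, pow_succ (1 / 2 : ℝ)]
    ring

lemma tendsto_sum_unitTent_mul {u v : ℝ} (hu : 0 ≤ u) (hv : 0 ≤ v) (hu1 : u ≤ 1) (hv1 : v ≤ 1) :
    Tendsto (fun n : ℕ => ∑ j ∈ Finset.range n, ∑ k ∈ Finset.range (2 ^ j),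
        (1 / 2 : ℝ) ^ j * (unitTent (2 ^ j * u - k) * unitTent (2 ^ j * v - k)))
      atTop (nhds (min u v - u * v)) := by
  wlog huv : u ≤ v generalizing u v
  · convert this hv hu hv1 hu1 (le_of_not_ge huv) using 1
    · ext n
      simp_rw [mul_comm (unitTent (2 ^ _ * u - _))]
    · rw [min_comm, mul_comm]
  simp_rw [sum_unitTent_mul]
  have hc {w : ℝ} (h0 : 0 ≤ w) (h1 : w ≤ 1) : unitClamp w = w := by
    unfold unitClamp; grind
  rw [hc hu hu1, hc hv hv1, min_eq_left huv]
  refine Tendsto.sub_const ?_ _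
  rw [tendsto_iff_norm_sub_tendsto_zero]
  refine squeeze_zero (fun _ => norm_nonneg _) (fun n => ?_)
    (tendsto_pow_atTop_nhds_zero_of_lt_one (r := (1 / 2 : ℝ)) (by norm_num) (by norm_num))
  have h2 : (0 : ℝ) < 2 ^ n := by positivity
  have h := abs_sum_unitClamp_mul_sub_le (x := 2 ^ n * u) (y := 2 ^ n * v) (n := 2 ^ n)
    (by positivity) (by gcongr) (by push_cast; nlinarith)
  rw [Real.norm_eq_abs]
  have h3 : u = (1 / 2 : ℝ) ^ n * (2 ^ n * u) := by
    rw [← mul_assoc, ← mul_pow]; norm_num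
  conv_lhs => enter [1, 2]; rw [h3]
  rw [← mul_sub, abs_mul, abs_of_pos (by positivity)]
  nlinarith [show (0 : ℝ) < (1 / 2) ^ n by positivity]

section GaussianSeries

variable {Ω ι : Type*} [MeasurableSpace Ω] {P : Measure Ω} {ξ : ι → Ω → ℝ}

lemma charFun_sum_gaussian [IsProbabilityMeasure P] (hind : iIndepFun ξ P)
    (hlaw : ∀ i, HasLaw (ξ i) (gaussianReal 0 1) P) (s : Finset ι) (c : ι → ℝ) :
    ∫ ω, Complex.exp (((∑ i ∈ s, c i * ξ i ω : ℝ) : ℂ) * Complex.I) ∂P =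
      Complex.exp (-((∑ i ∈ s, c i ^ 2 : ℝ) : ℂ) / 2) := by
  have hg (i : ι) : HasGaussianLaw (fun ω => c i * ξ i ω) P :=
    (hlaw i).hasGaussianLaw.fun_smul (c i)
  have hind' : iIndepFun (fun i ω => c i * ξ i ω) P :=
    hind.comp (fun i x => c i * x) (fun i => by fun_prop)
  have hG : HasGaussianLaw (fun ω => ∑ i : s, c i * ξ i ω) P :=
    iIndepFun.hasGaussianLaw_fun_sum (X := fun (i : s) ω => c i * ξ i ω) (fun i => hg i)
      (hind'.precomp Subtype.val_injective)
  replace hG : HasGaussianLaw (fun ω => ∑ i ∈ s, c i * ξ i ω) P := by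
    convert hG using 2 with ω
    exact (Finset.sum_coe_sort s (fun i => c i * ξ i ω)).symm
  have hmean (i : ι) : ∫ ω, ξ i ω ∂P = 0 := by
    rw [(hlaw i).integral_eq, integral_id_gaussianReal]
  have hvar (i : ι) : Var[ξ i; P] = 1 := by
    rw [(hlaw i).variance_eq, variance_id_gaussianReal]; simp
  have h0 : ∫ ω, ∑ i ∈ s, c i * ξ i ω ∂P = 0 := by
    rw [integral_finsetSum _ fun i _ => (hg i).integrable]
    simp [integral_const_mul, hmean]
  have hV : Var[fun ω => ∑ i ∈ s, c i * ξ i ω; P] = ∑ i ∈ s, c i ^ 2 := by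
    have := IndepFun.variance_sum (s := s) (X := fun i ω => c i * ξ i ω) (μ := P)
      (fun i _ => (hg i).memLp_two) (fun i _ j _ hij => hind'.indepFun hij)
    rw [show (fun ω => ∑ i ∈ s, c i * ξ i ω) = ∑ i ∈ s, fun ω => c i * ξ i ω by
      ext; simp, this]
    exact Finset.sum_congr rfl fun i _ => by rw [variance_const_mul, hvar, mul_one]
  have hmap := hG.map_eq_gaussianReal
  rw [h0, hV] at hmap
  have h1 := charFun_gaussianReal (μ := 0) (v := (∑ i ∈ s, c i ^ 2).toNNReal) 1
  rw [← hmap, charFun_apply, integral_map hG.aemeasurable (by fun_prop)] at h1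
  have hnn : 0 ≤ ∑ i ∈ s, c i ^ 2 := Finset.sum_nonneg fun i _ => sq_nonneg _
  simp only [RCLike.inner_apply, mul_one, one_mul, Complex.ofReal_one,
    Complex.ofReal_zero, zero_mul, zero_sub, one_pow, Real.coe_toNNReal _ hnn] at h1
  rw [neg_div]
  simpa using h1

/-- A Gaussian series whose covariances converge to those of Brownian motion is
pre-Brownian. -/
lemma isPreBrownianReal_of_series [IsProbabilityMeasure P] (hind : iIndepFun ξ P)
    (hlaw : ∀ i, HasLaw (ξ i) (gaussianReal 0 1) P) (s : ℕ → Finset ι) (f : ι → NNReal → ℝ)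
    (hcov : ∀ a b, Tendsto (fun n => ∑ i ∈ s n, f i a * f i b) atTop
      (nhds (min (a : ℝ) b)))
    (X : NNReal → Ω → ℝ) (hX : ∀ a, AEMeasurable (X a) P)
    (hlim : ∀ a, ∀ᵐ ω ∂P, Tendsto (fun n => ∑ i ∈ s n, f i a * ξ i ω) atTop
      (nhds (X a ω))) :
    IsPreBrownianReal X P where
  hasLaw I := by
    have hm : AEMeasurable (fun ω => I.restrict (X · ω)) P :=
      aemeasurable_pi_lambda _ fun i => hX i
    refine ⟨hm, ?_⟩
    have hprob : IsProbabilityMeasure (P.map (fun ω => I.restrict (X · ω))) :=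
      Measure.isProbabilityMeasure_map hm
    apply (MeasurableEquiv.toLp 2 (I → ℝ)).map_measurableEquiv_injective
    rw [MeasurableEquiv.coe_toLp,
      (BrownianReal.measurePreserving_toLp_projectiveFamily I).map_eq]
    have : IsProbabilityMeasure ((P.map (fun ω => I.restrict (X · ω))).map (WithLp.toLp 2)) :=
      Measure.isProbabilityMeasure_map (by fun_prop)
    apply Measure.ext_of_charFun
    ext a
    rw [charFun_multivariateGaussian (BrownianReal.posSemidef_covMatrix I), charFun_apply,
      integral_map (by fun_prop) (by fun_prop), integral_map hm (by fun_prop)]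
    have hinner (ω : Ω) : inner ℝ (WithLp.toLp 2 (I.restrict (X · ω))) a =
        ∑ i : I, a i * X i ω := by
      simp [PiLp.inner_apply]
    simp_rw [hinner]
    have hswap (n : ℕ) (ω : Ω) : ∑ j : I, a j * ∑ i ∈ s n, f i j * ξ i ω =
        ∑ i ∈ s n, (∑ j : I, a j * f i j) * ξ i ω := by
      simp_rw [Finset.mul_sum, Finset.sum_mul]
      rw [Finset.sum_comm]
      exact Finset.sum_congr rfl fun _ _ => Finset.sum_congr rfl fun _ _ => by ring
    have hξ (i : ι) : AEMeasurable (ξ i) P := (hlaw i).aemeasurable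
    have hL : Tendsto (fun n => ∫ ω, Complex.exp
        (((∑ i ∈ s n, (∑ j : I, a j * f i j) * ξ i ω : ℝ) : ℂ) * Complex.I) ∂P) atTop
        (nhds (∫ ω, Complex.exp (((∑ j : I, a j * X j ω : ℝ) : ℂ) * Complex.I) ∂P)) := by
      refine tendsto_integral_of_dominated_convergence (fun _ => 1) (fun n => ?_)
        (integrable_const _) (fun n => ?_) ?_
      · refine AEMeasurable.aestronglyMeasurable ?_
        fun_prop
      · filter_upwards with ω
        rw [Complex.norm_exp_ofReal_mul_I]
      · have hall : ∀ᵐ ω ∂P, ∀ j : I, Tendsto (fun n => ∑ i ∈ s n, f i j * ξ i ω) atTop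
            (nhds (X j ω)) := ae_all_iff.2 fun j => hlim j
        filter_upwards [hall] with ω hω
        have h1 : Tendsto (fun n => ∑ j : I, a j * ∑ i ∈ s n, f i j * ξ i ω) atTop
            (nhds (∑ j : I, a j * X j ω)) :=
          tendsto_finsetSum _ fun j _ => (hω j).const_mul _
        simp_rw [hswap] at h1
        exact ((Complex.continuous_exp.comp
          (Complex.continuous_ofReal.mul continuous_const)).tendsto _).comp h1
    simp_rw [charFun_sum_gaussian hind hlaw] at hL
    refine tendsto_nhds_unique hL ?_
    have hq : Tendsto (fun n => ∑ i ∈ s n, (∑ j : I, a j * f i j) ^ 2) atTop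
        (nhds (a.ofLp ⬝ᵥ BrownianReal.covMatrix I *ᵥ a.ofLp)) := by
      have h1 (n : ℕ) : ∑ i ∈ s n, (∑ j : I, a j * f i j) ^ 2 =
          ∑ j : I, a j * ∑ k : I, (∑ i ∈ s n, f i j * f i k) * a k := by
        simp_rw [sq, Finset.mul_sum, Finset.sum_mul, Finset.mul_sum]
        rw [Finset.sum_comm]
        refine Finset.sum_congr rfl fun j _ => ?_
        rw [Finset.sum_comm]
        exact Finset.sum_congr rfl fun _ _ => Finset.sum_congr rfl fun _ _ => by ring
      simp_rw [h1]
      refine tendsto_finsetSum _ fun j _ => Tendsto.const_mul _ ?_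
      refine tendsto_finsetSum _ fun k _ => Tendsto.mul_const _ ?_
      simpa using hcov j k
    have := ((Complex.continuous_exp.comp
      ((Complex.continuous_ofReal.neg).div_const 2)).tendsto _).comp hq
    simpa [Function.comp_def, neg_div] using this

end GaussianSeries
lemma exists_fourth_root_half : ∃ q : ℝ, 0 < q ∧ q < 1 ∧ q ^ 4 = 1 / 2 := by
  refine ⟨√(√(1 / 2)), by positivity, ?_, ?_⟩
  · rw [Real.sqrt_lt' one_pos, one_pow, Real.sqrt_lt' one_pos]
    norm_num
  · rw [show √(√(1 / 2 : ℝ)) ^ 4 = (√(√(1 / 2)) ^ 2) ^ 2 by ring,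
      Real.sq_sqrt (by positivity), Real.sq_sqrt (by positivity)]

lemma lintegral_ofReal_pow_gaussian_lt_top :
    ∫⁻ x, ENNReal.ofReal (|x| ^ 8) ∂(gaussianReal 0 1) < ⊤ := by
  have h := (memLp_id_gaussianReal (μ := 0) (v := 1) 8).eLpNorm_lt_top
  have h8 := (eLpNorm_lt_top_iff_lintegral_rpow_enorm_lt_top
    (p := ((8 : NNReal) : ENNReal)) (by norm_num) (by norm_num)).1 h
  refine lt_of_le_of_lt (lintegral_mono fun x => ?_) h8
  rw [ENNReal.ofReal_pow (abs_nonneg _), ← Real.norm_eq_abs, ofReal_norm]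
  refine le_of_eq ?_
  rw [← ENNReal.rpow_natCast]
  simp

section SchauderSeries

/-- The level `j` block of the Schauder series with coefficients `ω`. -/
def schauderBlock (q : ℝ) (ω : ((_ : ℕ) × ℕ) → ℝ) (j : ℕ) (u : ℝ) : ℝ :=
  ∑ k ∈ Finset.range (2 ^ j), q ^ (2 * j) * unitTent (2 ^ j * u - k) * ω ⟨j, k⟩

/-- Coefficient sequences that grow slowly enough for the Schauder series to converge
uniformly. -/
def schauderGood (q : ℝ) : Set (((_ : ℕ) × ℕ) → ℝ) :=
  {ω | ∑' j : ℕ, ∑ k ∈ Finset.range (2 ^ j), ENNReal.ofReal ((q ^ j * |ω ⟨j, k⟩|) ^ 8) < ⊤}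

lemma measurableSet_schauderGood (q : ℝ) : MeasurableSet (schauderGood q) := by
  refine measurableSet_lt (Measurable.tsum fun j => ?_) measurable_const
  fun_prop

variable {q : ℝ}

lemma continuous_schauderBlock (ω : ((_ : ℕ) × ℕ) → ℝ) (j : ℕ) :
    Continuous (schauderBlock q ω j) := by
  have := continuous_unitTent
  unfold schauderBlock
  fun_prop

lemma measurable_schauderBlock (j : ℕ) (u : ℝ) :
    Measurable fun ω => schauderBlock q ω j u := by
  unfold schauderBlock
  fun_prop

lemma schauderGood.exists_bound (hq : 0 < q) {ω : ((_ : ℕ) × ℕ) → ℝ} (hω : ω ∈ schauderGood q) :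
    ∃ C : ℝ, ∀ (j : ℕ) (u : ℝ), ‖schauderBlock q ω j u‖ ≤ C * q ^ j := by
  set S := ∑' j : ℕ, ∑ k ∈ Finset.range (2 ^ j), ENNReal.ofReal ((q ^ j * |ω ⟨j, k⟩|) ^ 8) with hS
  have hS' : S ≠ ⊤ := (show S < ⊤ from hω).ne
  refine ⟨max 1 S.toReal, fun j u => ?_⟩
  have hk : ∀ k ∈ Finset.range (2 ^ j), q ^ j * |ω ⟨j, k⟩| ≤ max 1 S.toReal := by
    intro k hk
    have h1 : ENNReal.ofReal ((q ^ j * |ω ⟨j, k⟩|) ^ 8) ≤ S :=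
      (Finset.single_le_sum (f := fun k => ENNReal.ofReal ((q ^ j * |ω ⟨j, k⟩|) ^ 8))
        (fun _ _ => zero_le) hk).trans
        (ENNReal.le_tsum (f := fun j : ℕ => ∑ k ∈ Finset.range (2 ^ j),
          ENNReal.ofReal ((q ^ j * |ω ⟨j, k⟩|) ^ 8)) j)
    have h2 : (q ^ j * |ω ⟨j, k⟩|) ^ 8 ≤ S.toReal := by
      rwa [ENNReal.ofReal_le_iff_le_toReal hS'] at h1
    rcases le_total (q ^ j * |ω ⟨j, k⟩|) 1 with h | h
    · exact h.trans (le_max_left _ _)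
    · exact ((le_self_pow₀ h (by norm_num)).trans h2).trans (le_max_right _ _)
  unfold schauderBlock
  refine (norm_sum_le _ _).trans ?_
  have hle : ∀ k ∈ Finset.range (2 ^ j), ‖q ^ (2 * j) * unitTent (2 ^ j * u - k) * ω ⟨j, k⟩‖ ≤
      max 1 S.toReal * q ^ j * unitTent (2 ^ j * u - k) := by
    intro k hk'
    rw [norm_mul, norm_mul, Real.norm_eq_abs, Real.norm_eq_abs, Real.norm_eq_abs,
      abs_of_nonneg (unitTent_nonneg _), abs_of_pos (by positivity), two_mul, pow_add]
    have := hk k hk'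
    have h1 : 0 ≤ q ^ j * unitTent (2 ^ j * u - k) :=
      mul_nonneg (by positivity) (unitTent_nonneg _)
    nlinarith
  refine (Finset.sum_le_sum hle).trans ?_
  rw [← Finset.mul_sum]
  exact mul_le_of_le_one_right (by positivity) (sum_unitTent_le_one _ _)

lemma ae_mem_schauderGood (hq4 : q ^ 4 = 1 / 2) :
    ∀ᵐ ω ∂(Measure.infinitePi fun _ : (_ : ℕ) × ℕ => gaussianReal 0 1),
      ω ∈ schauderGood q := by
  refine ae_lt_top (Measurable.tsum fun j => by fun_prop) ?_
  rw [lintegral_tsum fun j => Measurable.aemeasurable (by fun_prop)]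
  have hterm (i : (_ : ℕ) × ℕ) (j : ℕ) :
      ∫⁻ ω, ENNReal.ofReal ((q ^ j * |ω i|) ^ 8)
        ∂(Measure.infinitePi fun _ : (_ : ℕ) × ℕ => gaussianReal 0 1) =
      ENNReal.ofReal ((1 / 4) ^ j) * ∫⁻ x, ENNReal.ofReal (|x| ^ 8) ∂(gaussianReal 0 1) := by
    rw [← (measurePreserving_eval_infinitePi
      (fun _ : (_ : ℕ) × ℕ => gaussianReal 0 1) i).lintegral_comp (by fun_prop),
      ← lintegral_const_mul _ (by fun_prop)]
    refine lintegral_congr fun ω => ?_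
    rw [← ENNReal.ofReal_mul (by positivity), mul_pow, ← pow_mul, mul_comm j, pow_mul,
      show q ^ 8 = 1 / 4 by rw [show q ^ 8 = (q ^ 4) ^ 2 by ring, hq4]; norm_num]
  have hsum (j : ℕ) : ∫⁻ ω, ∑ k ∈ Finset.range (2 ^ j), ENNReal.ofReal ((q ^ j * |ω ⟨j, k⟩|) ^ 8)
        ∂(Measure.infinitePi fun _ : (_ : ℕ) × ℕ => gaussianReal 0 1) =
      ENNReal.ofReal ((1 / 2) ^ j) * ∫⁻ x, ENNReal.ofReal (|x| ^ 8) ∂(gaussianReal 0 1) := by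
    rw [lintegral_finsetSum _ fun k _ => by fun_prop]
    simp_rw [hterm]
    rw [Finset.sum_const, Finset.card_range, nsmul_eq_mul, ← mul_assoc]
    congr 1
    rw [← ENNReal.ofReal_natCast, ← ENNReal.ofReal_mul (by positivity)]
    push_cast
    rw [← mul_pow]
    norm_num
  simp_rw [hsum]
  rw [ENNReal.tsum_mul_right]
  refine ENNReal.mul_ne_top ?_ lintegral_ofReal_pow_gaussian_lt_top.ne
  exact (summable_geometric_of_lt_one (by norm_num) (by norm_num)).tsum_ofReal_ne_top

/-- The rescaled Brownian bridge obtained from the Schauder series with coefficients `ω`. -/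
def schauderPath (q : ℝ) (s : ℝ) (ω : ((_ : ℕ) × ℕ) → ℝ) : ℝ :=
  if ω ∈ schauderGood q then
    (1 + max s 0) * ∑' j, schauderBlock q ω j (max s 0 / (1 + max s 0))
  else 0

lemma schauderGood.summable (hq : 0 < q) (hq1 : q < 1) {ω : ((_ : ℕ) × ℕ) → ℝ}
    (hω : ω ∈ schauderGood q) (u : ℝ) : Summable fun j => schauderBlock q ω j u := by
  obtain ⟨C, hC⟩ := schauderGood.exists_bound hq hω
  exact Summable.of_norm_bounded
    ((summable_geometric_of_lt_one hq.le hq1).mul_left C) fun j => hC j u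

lemma continuous_schauderPath (hq : 0 < q) (hq1 : q < 1) (ω : ((_ : ℕ) × ℕ) → ℝ) :
    Continuous fun s => schauderPath q s ω := by
  unfold schauderPath
  by_cases hω : ω ∈ schauderGood q
  · simp only [hω, if_true]
    obtain ⟨C, hC⟩ := schauderGood.exists_bound hq hω
    have h1 : Continuous fun u => ∑' j, schauderBlock q ω j u :=
      continuous_tsum (continuous_schauderBlock ω)
        ((summable_geometric_of_lt_one hq.le hq1).mul_left C) hC
    have h2 : Continuous fun s : ℝ => max s 0 / (1 + max s 0) := by
      refine Continuous.div (by fun_prop) (by fun_prop) fun s => ?_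
      have := le_max_right s 0
      positivity
    exact Continuous.mul (by fun_prop) (h1.comp h2)
  · simp only [hω, if_false]
    exact continuous_const

lemma measurable_schauderPath (hq : 0 < q) (hq1 : q < 1) (s : ℝ) :
    Measurable (schauderPath q s) := by
  have hG := measurableSet_schauderGood q
  refine measurable_of_tendsto_metrizable (f := fun n ω => if ω ∈ schauderGood q then
    (1 + max s 0) * ∑ j ∈ Finset.range n, schauderBlock q ω j (max s 0 / (1 + max s 0)) else 0)
    (fun n => ?_) ?_
  · refine Measurable.ite hG ?_ measurable_const
    exact (Finset.measurable_sum _ fun j _ => measurable_schauderBlock j _).const_mul _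
  · rw [tendsto_pi_nhds]
    intro ω
    by_cases hω : ω ∈ schauderGood q
    · simp only [schauderPath, hω, if_true]
      exact (schauderGood.summable hq hq1 hω _).hasSum.tendsto_sum_nat.const_mul _
    · simp [schauderPath, hω]

lemma schauderPath_zero (ω : ((_ : ℕ) × ℕ) → ℝ) : schauderPath q 0 ω = 0 := by
  have h (j : ℕ) : schauderBlock q ω j 0 = 0 := by
    refine Finset.sum_eq_zero fun k _ => ?_
    have : unitTent (2 ^ j * 0 - k) = 0 := by
      have : (0 : ℝ) ≤ k := k.cast_nonneg
      unfold unitTent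
      grind
    rw [this]
    ring
  simp [schauderPath, h]

lemma isPreBrownianReal_schauderPath (hq : 0 < q) (hq1 : q < 1) (hq4 : q ^ 4 = 1 / 2) :
    IsPreBrownianReal (fun a : NNReal => schauderPath q a)
      (Measure.infinitePi fun _ : (_ : ℕ) × ℕ => gaussianReal 0 1) := by
  refine isPreBrownianReal_of_series (ξ := fun i ω => ω i)
    (iIndepFun_infinitePi (X := fun _ x => x) fun _ => measurable_id)
    (fun i => (measurePreserving_eval_infinitePi
      (fun _ : (_ : ℕ) × ℕ => gaussianReal 0 1) i).hasLaw)
    (fun n => (Finset.range n).sigma fun j => Finset.range (2 ^ j))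
    (fun i a => (1 + a) * (q ^ (2 * i.1) * unitTent (2 ^ i.1 * (a / (1 + a)) - i.2)))
    (fun a b => ?_) _ (fun a => (measurable_schauderPath hq hq1 a).aemeasurable) (fun a => ?_)
  · have ha : (0 : ℝ) ≤ a := a.2
    have hb : (0 : ℝ) ≤ b := b.2
    have h := (tendsto_sum_unitTent_mul (u := a / (1 + a)) (v := b / (1 + b)) (by positivity)
      (by positivity) (by rw [div_le_one (by positivity)]; linarith)
      (by rw [div_le_one (by positivity)]; linarith)).const_mul ((1 + a) * (1 + b) : ℝ)
    have hlim : ((1 + a) * (1 + b) : ℝ) *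
        (min ((a : ℝ) / (1 + a)) (b / (1 + b)) - a / (1 + a) * (b / (1 + b))) = min (a : ℝ) b := by
      rcases le_total (a : ℝ) b with hab | hab
      · have : (a : ℝ) / (1 + a) ≤ b / (1 + b) := by
          rw [div_le_div_iff₀ (by positivity) (by positivity)]; nlinarith
        rw [min_eq_left hab, min_eq_left this]
        field_simp
        ring
      · have : (b : ℝ) / (1 + b) ≤ a / (1 + a) := by
          rw [div_le_div_iff₀ (by positivity) (by positivity)]; nlinarith
        rw [min_eq_right hab, min_eq_right this]
        field_simp
        ring
    rw [hlim] at h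
    refine h.congr fun n => ?_
    rw [Finset.sum_sigma, Finset.mul_sum]
    refine Finset.sum_congr rfl fun j _ => ?_
    rw [Finset.mul_sum]
    refine Finset.sum_congr rfl fun k _ => ?_
    have hqj : (1 / 2 : ℝ) ^ j = q ^ (2 * j) * q ^ (2 * j) := by
      rw [← hq4, ← pow_mul, ← pow_add]
      congr 1
      ring
    rw [hqj]
    ring
  · filter_upwards [ae_mem_schauderGood hq4] with ω hω
    have h := ((schauderGood.summable hq hq1 hω
      ((a : ℝ) / (1 + a))).hasSum.tendsto_sum_nat).const_mul (1 + a : ℝ)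
    have ha : max (a : ℝ) 0 = a := max_eq_left a.2
    simp only [schauderPath, hω, if_true, ha]
    refine h.congr fun n => ?_
    rw [Finset.sum_sigma, Finset.mul_sum]
    refine Finset.sum_congr rfl fun j _ => ?_
    rw [schauderBlock, Finset.mul_sum]
    exact Finset.sum_congr rfl fun k _ => by ring

end SchauderSeries

/-- Existence of Brownian motion with respect to its natural filtration. -/
theorem exists_isBM : ∃ (Ω : Type) (_ : MeasurableSpace Ω) (P : Measure Ω) (B : ℝ → Ω → ℝ),
    IsProbabilityMeasure P ∧ (∀ s, Measurable (B s)) ∧ IsBM P (natFilt B) B := by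
  obtain ⟨q, hq, hq1, hq4⟩ := exists_fourth_root_half
  have hpre := isPreBrownianReal_schauderPath hq hq1 hq4
  refine ⟨_, inferInstance, Measure.infinitePi fun _ : (_ : ℕ) × ℕ => gaussianReal 0 1,
    schauderPath q, inferInstance, measurable_schauderPath hq hq1, schauderPath_zero,
    continuous_schauderPath hq hq1, fun s hs => ?_, fun s u hs hsu => ⟨?_, ?_⟩⟩
  · exact (comap_measurable _).mono (le_iSup₂_of_le s ⟨hs, le_rfl⟩ le_rfl) le_rfl
  · lift s to NNReal using hs
    lift u to NNReal using s.2.trans hsu.le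
    have h := (hpre.hasLaw_sub u s).map_eq
    refine h.trans ?_
    congr 1
    ext
    rw [coe_nndist, Real.coe_toNNReal _ (sub_nonneg.2 hsu.le)]
    exact abs_of_pos (sub_pos.2 hsu)
  · lift s to NNReal using hs
    obtain ⟨v, hv⟩ : ∃ v : NNReal, (v : ℝ) = u - s := ⟨⟨u - s, sub_nonneg.2 hsu.le⟩, rfl⟩
    have h' := (hpre.indepFun_shift s).comp (measurable_pi_apply v) measurable_id
    have h'' := indep_of_indep_of_le_right (m₃ := natFilt (schauderPath q) s)
      ((IndepFun_iff_Indep _ _ _).1 h') ?_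
    · convert h'' using 2
      ext ω
      change schauderPath q u ω - schauderPath q s ω =
        schauderPath q ((s + v : NNReal) : ℝ) ω - schauderPath q s ω
      rw [NNReal.coe_add, hv, add_sub_cancel]
    · refine iSup₂_le fun r hr => ?_
      rw [← measurable_iff_comap_le]
      lift r to NNReal using hr.1
      have hm := comap_measurable (m := MeasurableSpace.pi)
        (fun ω (a : Set.Iic s) => schauderPath q a ω)
      exact (measurable_pi_apply (X := fun _ : Set.Iic s => ℝ) ⟨r, hr.2⟩).comp hm

section TimeGrid

variable {T : ℝ} {t : ℤ → ℝ}

lemma TsirelsonTimes.strictMonoOn (ht : TsirelsonTimes T t) : StrictMonoOn t (Set.Iic 0) := by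
  have key (n : ℕ) (k : ℤ) (hk : k ≤ 0) : t (k - (n + 1)) < t k := by
    induction n with
    | zero => simpa using ht.2.1 k hk
    | succ n ih =>
      have := ht.2.1 (k - (n + 1)) (by omega)
      rw [sub_sub] at this
      exact lt_trans (by exact_mod_cast this) ih
  intro j _ k hk hjk
  have h := key (k - j - 1).toNat k hk
  rwa [Int.toNat_of_nonneg (by omega), show k - (k - j - 1 + 1) = j by ring] at h

lemma TsirelsonTimes.pos (ht : TsirelsonTimes T t) {k : ℤ} (hk : k ≤ 0) : 0 < t k := by
  refine lt_of_le_of_lt ?_ (ht.2.1 k hk)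
  refine le_of_tendsto ht.2.2 ?_
  filter_upwards [eventually_ge_atTop (1 - k).toNat] with n hn
  exact ht.strictMonoOn.monotoneOn (show -(n : ℤ) ≤ 0 by omega) (show k - 1 ≤ 0 by omega)
    (by omega)

lemma TsirelsonTimes.exists_mem_Ico (ht : TsirelsonTimes T t) {s : ℝ} (hs : 0 < s) (hsT : s < T) :
    ∃ k : ℤ, k ≤ -1 ∧ t k ≤ s ∧ s < t (k + 1) := by
  have hex : ∃ n : ℕ, t (-(n : ℤ)) ≤ s := (ht.2.2.eventually_le_const hs).exists
  obtain ⟨n, hn, hmin⟩ : ∃ n : ℕ, t (-(n : ℤ)) ≤ s ∧ ∀ m < n, ¬ t (-(m : ℤ)) ≤ s :=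
    ⟨Nat.find hex, Nat.find_spec hex, fun m hm => Nat.find_min hex hm⟩
  obtain _ | n := n
  · simp only [Nat.cast_zero, neg_zero, ht.1] at hn
    linarith
  · refine ⟨-((n + 1 : ℕ) : ℤ), by omega, hn, ?_⟩
    have := not_le.1 (hmin n n.lt_succ_self)
    rwa [show -((n + 1 : ℕ) : ℤ) + 1 = -(n : ℤ) by omega]

lemma TsirelsonTimes.exists_last_le (ht : TsirelsonTimes T t) {s : ℝ} (hs : 0 < s) :
    ∃ k : ℤ, k ≤ 0 ∧ t k ≤ s ∧ ∀ j ≤ 0, t j ≤ s → j ≤ k := by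
  rcases lt_or_ge s T with hsT | hsT
  · obtain ⟨k, hk, hks, hsk⟩ := ht.exists_mem_Ico hs hsT
    refine ⟨k, by omega, hks, fun j hj hjs => ?_⟩
    have := (ht.strictMonoOn.lt_iff_lt hj (show k + 1 ≤ 0 by omega)).1 (hjs.trans_lt hsk)
    omega
  · exact ⟨0, le_rfl, ht.1.trans_le hsT, fun j hj _ => hj⟩

/-- The process equal to `θ k` on `[t k, t (k + 1))` for `k ≤ -1` and to `0` elsewhere. -/
def stepProcess {Ω : Type*} (t : ℤ → ℝ) (θ : ℤ → Ω → ℝ) (s : ℝ) (ω : Ω) : ℝ :=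
  if h : ∃ k : ℤ, k ≤ -1 ∧ t k ≤ s ∧ s < t (k + 1) then θ h.choose ω else 0

lemma TsirelsonTimes.eq_of_mem_Ico (ht : TsirelsonTimes T t) {s : ℝ} {j k : ℤ}
    (hj : j ≤ -1 ∧ t j ≤ s ∧ s < t (j + 1)) (hk : k ≤ -1 ∧ t k ≤ s ∧ s < t (k + 1)) : j = k := by
  have h1 := (ht.strictMonoOn.lt_iff_lt (show j ≤ 0 by omega) (show k + 1 ≤ 0 by omega)).1
    (hj.2.1.trans_lt hk.2.2)
  have h2 := (ht.strictMonoOn.lt_iff_lt (show k ≤ 0 by omega) (show j + 1 ≤ 0 by omega)).1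
    (hk.2.1.trans_lt hj.2.2)
  omega

variable {Ω : Type*} {θ : ℤ → Ω → ℝ}

lemma stepProcess_eq (ht : TsirelsonTimes T t) {s : ℝ} {k : ℤ}
    (hk : k ≤ -1 ∧ t k ≤ s ∧ s < t (k + 1)) (ω : Ω) : stepProcess t θ s ω = θ k ω := by
  have h : ∃ k : ℤ, k ≤ -1 ∧ t k ≤ s ∧ s < t (k + 1) := ⟨k, hk⟩
  rw [stepProcess, dif_pos h, ht.eq_of_mem_Ico h.choose_spec hk]

lemma stepProcess_mem_Icc (hθ : ∀ k ω, θ k ω ∈ Set.Icc (0 : ℝ) 1) (s : ℝ) (ω : Ω) :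
    stepProcess t θ s ω ∈ Set.Icc (0 : ℝ) 1 := by
  unfold stepProcess
  split_ifs
  · exact hθ _ _
  · simp

lemma measurable_stepProcess {β : Type*} [MeasurableSpace β] (ht : TsirelsonTimes T t)
    {p : β → ℝ} (hp : Measurable p) {g : β → Ω}
    (hg : ∀ k ≤ -1, (∃ b, t k ≤ p b) → Measurable fun b => θ k (g b)) :
    Measurable fun b => stepProcess t θ (p b) (g b) := by
  have hI (k : ℤ) : MeasurableSet {b | k ≤ -1 ∧ t k ≤ p b ∧ p b < t (k + 1)} :=
    (MeasurableSet.const _).inter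
      ((measurableSet_le measurable_const hp).inter (measurableSet_lt hp measurable_const))
  intro E hE
  have hEq : (fun b => stepProcess t θ (p b) (g b)) ⁻¹' E =
      (⋃ k : ℤ, {b | k ≤ -1 ∧ t k ≤ p b ∧ p b < t (k + 1)} ∩ {b | θ k (g b) ∈ E}) ∪
        ((⋃ k : ℤ, {b | k ≤ -1 ∧ t k ≤ p b ∧ p b < t (k + 1)})ᶜ ∩ {_b | (0 : ℝ) ∈ E}) := by
    ext b
    by_cases h : ∃ k : ℤ, k ≤ -1 ∧ t k ≤ p b ∧ p b < t (k + 1)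
    · obtain ⟨k, hk⟩ := h
      simp only [mem_preimage, stepProcess_eq ht hk, mem_union, mem_iUnion, mem_inter_iff,
        mem_compl_iff, mem_ofPred_eq]
      constructor
      · exact fun hb => Or.inl ⟨k, hk, hb⟩
      · rintro (⟨j, hj, hb⟩ | ⟨hn, -⟩)
        · rwa [ht.eq_of_mem_Ico hk hj]
        · exact absurd ⟨k, hk⟩ hn
    · simp only [mem_preimage, stepProcess, dif_neg h, mem_union, mem_iUnion, mem_inter_iff,
        mem_compl_iff, mem_ofPred_eq]
      constructor
      · exact fun hb => Or.inr ⟨h, hb⟩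
      · rintro (⟨j, hj, hb⟩ | ⟨-, hb⟩)
        · exact absurd ⟨j, hj⟩ h
        · exact hb
  rw [hEq]
  refine (MeasurableSet.iUnion fun k => ?_).union
    ((MeasurableSet.iUnion hI).compl.inter (MeasurableSet.const _))
  by_cases h : k ≤ -1 ∧ ∃ b, t k ≤ p b
  · exact (hI k).inter (hg k h.1 h.2 hE)
  · convert MeasurableSet.empty
    ext b
    simp only [mem_inter_iff, mem_ofPred_eq, mem_empty_iff_false, iff_false]
    exact fun hb => h ⟨hb.1.1, b, hb.1.2.1⟩

lemma progMeas_stepProcess (ht : TsirelsonTimes T t) {F : ℝ → MeasurableSpace Ω}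
    (hθ : ∀ s, ∀ k ≤ -1, t k ≤ s → Measurable[F s] (θ k)) : ProgMeas F (stepProcess t θ) := by
  intro s _
  let _ := F s
  exact measurable_stepProcess ht (measurable_subtype_coe.comp measurable_fst)
    fun k hk ⟨b, hb⟩ => (hθ s k hk (hb.trans b.1.2.2)).comp measurable_snd

lemma intervalIntegrable_stepProcess (ht : TsirelsonTimes T t)
    (hθ : ∀ k ω, θ k ω ∈ Set.Icc (0 : ℝ) 1) (a b : ℝ) (ω : Ω) :
    IntervalIntegrable (fun r => stepProcess t θ r ω) volume a b := by
  have hm : Measurable fun r => stepProcess t θ r ω :=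
    measurable_stepProcess ht measurable_id fun _ _ _ => measurable_const
  refine (intervalIntegrable_const (c := (1 : ℝ))).mono_fun hm.aestronglyMeasurable ?_
  refine ae_of_all _ fun r => ?_
  have := stepProcess_mem_Icc (t := t) hθ r ω
  simpa [abs_of_nonneg this.1] using this.2

lemma integral_stepProcess (ht : TsirelsonTimes T t) {k : ℤ} (hk : k ≤ -1) {a b : ℝ}
    (hab : a ≤ b) (ha : t k ≤ a) (hb : b ≤ t (k + 1)) (ω : Ω) :
    ∫ r in a..b, stepProcess t θ r ω = (b - a) * θ k ω := by
  rw [intervalIntegral.integral_of_le hab, ← integral_Ico_eq_integral_Ioc,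
    setIntegral_congr_fun measurableSet_Ico (g := fun _ => θ k ω) fun r hr =>
      stepProcess_eq ht ⟨hk, ha.trans hr.1, hr.2.trans_le hb⟩ ω]
  simp [hab]

lemma tsirelsonDrift_eq_stepProcess (s : ℝ) (x : Ω → ℝ → ℝ) (ω : Ω) :
    tsirelsonDrift t s (x ω) = stepProcess t (fun k ω =>
      Int.fract ((x ω (t k) - x ω (t (k - 1))) / (t k - t (k - 1)))) s ω := rfl

/-- The process `B` with the drift `stepProcess t θ` added. -/
def driftedProcess (t : ℤ → ℝ) (θ : ℤ → Ω → ℝ) (B : ℝ → Ω → ℝ) (s : ℝ) (ω : Ω) : ℝ :=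
  (∫ r in (0 : ℝ)..s, stepProcess t θ r ω) + B s ω

variable {B : ℝ → Ω → ℝ}

lemma driftedProcess_sub (ht : TsirelsonTimes T t) (hθ : ∀ k ω, θ k ω ∈ Set.Icc (0 : ℝ) 1)
    {k : ℤ} (hk : k ≤ -1) {a b : ℝ}
    (hab : a ≤ b) (ha : t k ≤ a) (hb : b ≤ t (k + 1)) (ω : Ω) :
    driftedProcess t θ B b ω - driftedProcess t θ B a ω =
      (b - a) * θ k ω + (B b ω - B a ω) := by
  rw [← integral_stepProcess ht hk hab ha hb, driftedProcess, driftedProcess,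
    ← intervalIntegral.integral_interval_sub_left (intervalIntegrable_stepProcess ht hθ 0 b ω)
      (intervalIntegrable_stepProcess ht hθ 0 a ω)]
  ring

lemma continuous_driftedProcess (ht : TsirelsonTimes T t)
    (hθ : ∀ k ω, θ k ω ∈ Set.Icc (0 : ℝ) 1) (hB : ∀ ω, Continuous fun s => B s ω) (ω : Ω) :
    Continuous fun s => driftedProcess t θ B s ω :=
  (intervalIntegral.continuous_primitive
    (fun a b => intervalIntegrable_stepProcess ht hθ a b ω) 0).add (hB ω)

lemma driftedProcess_eq_setIntegral {s : ℝ} (hs : 0 ≤ s) (ω : Ω) :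
    driftedProcess t θ B s ω = (∫ r in Set.Icc (0 : ℝ) s, stepProcess t θ r ω) + B s ω := by
  rw [driftedProcess, intervalIntegral.integral_of_le hs, integral_Icc_eq_integral_Ioc]

lemma measurable_driftedProcess {F : ℝ → MeasurableSpace Ω} (hF : ProgMeas F (stepProcess t θ))
    {s : ℝ} (hs : 0 ≤ s) (hB : Measurable[F s] (B s)) :
    Measurable[F s] (driftedProcess t θ B s) := by
  let _ := F s
  have hm : Measurable fun p : Set.Icc (0 : ℝ) s × Ω => stepProcess t θ p.1 p.2 := hF s hs
  have : IsFiniteMeasure ((volume : Measure ℝ).comap (Subtype.val : Set.Icc (0 : ℝ) s → ℝ)) :=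
    ⟨by
      rw [comap_subtype_coe_apply measurableSet_Icc, image_univ, Subtype.range_coe]
      exact measure_Icc_lt_top⟩
  have hintegral : Measurable fun ω => ∫ r : Set.Icc (0 : ℝ) s, stepProcess t θ r ω
      ∂(volume.comap Subtype.val) :=
    (hm.stronglyMeasurable.integral_prod_left' (μ := volume.comap Subtype.val)).measurable
  convert hintegral.add hB using 1
  ext ω
  rw [driftedProcess_eq_setIntegral hs, ← integral_subtype_comap measurableSet_Icc]
  rfl

lemma progMeas_driftedProcess (ht : TsirelsonTimes T t)
    (hθ : ∀ k ω, θ k ω ∈ Set.Icc (0 : ℝ) 1) {F : ℝ → MeasurableSpace Ω}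
    (hmono : ∀ s u : ℝ, s ≤ u → F s ≤ F u) (hF : ProgMeas F (stepProcess t θ))
    (hB : ∀ s, 0 ≤ s → Measurable[F s] (B s)) (hBc : ∀ ω, Continuous fun s => B s ω) :
    ProgMeas F (driftedProcess t θ B) := by
  intro s _
  let _ := F s
  refine measurable_uncurry_of_continuous_of_measurable
    (u := fun (r : Set.Icc (0 : ℝ) s) ω => driftedProcess t θ B r ω) (fun ω => ?_) fun r => ?_
  · exact (continuous_driftedProcess ht hθ hBc ω).comp continuous_subtype_val
  · exact (measurable_driftedProcess hF r.2.1 (hB r r.2.1)).mono (hmono _ _ r.2.2) le_rfl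

/-- The path `X = B + ∫ α` has left derivative `α` relative to `B` inside the grid intervals. -/
lemma alphaStar_driftedProcess (ht : TsirelsonTimes T t)
    (hθ : ∀ k ω, θ k ω ∈ Set.Icc (0 : ℝ) 1) {s : ℝ} {k : ℤ} (hk : k ≤ -1) (hks : t k < s)
    (hsk : s < t (k + 1)) (ω : Ω) :
    alphaStar s (fun r => B r ω) (fun r => driftedProcess t θ B r ω) = θ k ω := by
  have hev : (fun h : ℝ => ((driftedProcess t θ B s ω - B s ω) -
      (driftedProcess t θ B (max (s - h) 0) ω - B (max (s - h) 0) ω)) / h)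
      =ᶠ[nhdsWithin 0 (Set.Ioi 0)] fun _ => θ k ω := by
    filter_upwards [Ioo_mem_nhdsGT (sub_pos.2 hks)] with h hh
    have hpos := ht.pos (show k ≤ 0 by omega)
    rw [max_eq_left (by linarith [hh.2])]
    have := driftedProcess_sub (B := B) ht hθ hk (a := s - h) (b := s) (by linarith [hh.1])
      (by linarith [hh.2]) hsk.le ω
    rw [div_eq_iff hh.1.ne']
    linarith
  rw [alphaStar, limsup_congr hev, limsup_const, min_eq_right (hθ k ω).2,
    max_eq_right (hθ k ω).1]

lemma mem_tsirelsonSetD_driftedProcess (ht : TsirelsonTimes T t)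
    (hθ : ∀ k ω, θ k ω ∈ Set.Icc (0 : ℝ) 1) {ω : Ω}
    (hω : ∀ s, tsirelsonDrift t s (fun r => driftedProcess t θ B r ω) = stepProcess t θ s ω) :
    ((fun s => B s ω), (fun s => driftedProcess t θ B s ω)) ∈ tsirelsonSetD T t := by
  refine integral_eq_zero_of_ae ?_
  have h0 : ∀ᵐ s : ℝ, s ∉ insert 0 (Set.range t) :=
    ((Set.countable_range t).insert 0).ae_notMem volume
  filter_upwards [ae_restrict_mem measurableSet_Icc, ae_restrict_of_ae h0] with s hs hst
  simp only [mem_insert_iff, mem_range, not_or, not_exists] at hst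
  obtain ⟨k, hk, hks, hsk⟩ := ht.exists_mem_Ico (lt_of_le_of_ne hs.1 (Ne.symm hst.1))
    (lt_of_le_of_ne hs.2 fun h => hst.2 0 (ht.1.trans h.symm))
  rw [hω, alphaStar_driftedProcess ht hθ hk (lt_of_le_of_ne hks (hst.2 k)) hsk,
    stepProcess_eq ht ⟨hk, hks, hsk⟩]
  simp

end TimeGrid

section ProductIndependence

lemma indep_comap_fst_prod {Ω E : Type*} {m₁ m₂ mΩ : MeasurableSpace Ω} [mE : MeasurableSpace E]
    {P : Measure Ω} {Q : Measure E} [IsProbabilityMeasure P] [IsProbabilityMeasure Q]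
    (h₁ : m₁ ≤ mΩ) (h₂ : m₂ ≤ mΩ) (h : Indep m₁ m₂ P) :
    Indep (m₁.comap Prod.fst) (m₂.comap Prod.fst ⊔ mE.comap Prod.snd) (P.prod Q) := by
  refine IndepSets.indep (p1 := {s | MeasurableSet[m₁.comap Prod.fst] s})
    (p2 := Set.image2 (· ×ˢ ·) {s | MeasurableSet[m₂] s} {s | MeasurableSet s})
    ((MeasurableSpace.comap_mono h₁).trans measurable_fst.comap_le)
    (sup_le ((MeasurableSpace.comap_mono h₂).trans measurable_fst.comap_le)
      measurable_snd.comap_le)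
    (@MeasurableSpace.isPiSystem_measurableSet _ (m₁.comap Prod.fst))
    (@isPiSystem_prod _ _ m₂ _)
    (@MeasurableSpace.generateFrom_measurableSet _ (m₁.comap Prod.fst)).symm
    (@generateFrom_prod _ _ m₂ _).symm ?_
  rw [IndepSets_iff]
  rintro _ _ ⟨a, ha, rfl⟩ ⟨c, hc, d, hd, rfl⟩
  have hset : Prod.fst ⁻¹' a ∩ c ×ˢ d = (a ∩ c) ×ˢ d := by
    ext x
    simp [and_assoc]
  have hfst : (Prod.fst ⁻¹' a : Set (Ω × E)) = a ×ˢ Set.univ := by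
    ext x
    simp
  change P.prod Q (Prod.fst ⁻¹' a ∩ c ×ˢ d) = P.prod Q (Prod.fst ⁻¹' a) * P.prod Q (c ×ˢ d)
  rw [hset, hfst, Measure.prod_prod, Measure.prod_prod, Measure.prod_prod, measure_univ,
    (Indep_iff _ _ _).1 h a c ha hc, mul_one, mul_assoc]

lemma Indep.comap_measurePreserving {Ω Ω' : Type*} {mΩ : MeasurableSpace Ω}
    {m₁ m₂ mΩ' : MeasurableSpace Ω'} {P : Measure Ω} {P' : Measure Ω'} {Φ : Ω → Ω'}
    (hΦ : MeasurePreserving Φ P P') (h₁ : m₁ ≤ mΩ') (h₂ : m₂ ≤ mΩ')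
    (h : Indep m₁ m₂ P') : Indep (m₁.comap Φ) (m₂.comap Φ) P := by
  rw [Indep_iff] at h ⊢
  rintro _ _ ⟨a, ha, rfl⟩ ⟨b, hb, rfl⟩
  rw [← Set.preimage_inter, hΦ.measure_preimage ((h₁ _ ha).inter (h₂ _ hb)).nullMeasurableSet,
    hΦ.measure_preimage (h₁ _ ha).nullMeasurableSet,
    hΦ.measure_preimage (h₂ _ hb).nullMeasurableSet, h a b ha hb]

lemma measurePreserving_sub_skew {Ω : Type*} [MeasurableSpace Ω] (P : Measure Ω)
    [IsProbabilityMeasure P] {Q : Measure UnitAddCircle} [IsProbabilityMeasure Q]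
    [Q.IsAddRightInvariant] {c : Ω → UnitAddCircle} (hc : Measurable c) :
    MeasurePreserving (fun p : Ω × UnitAddCircle => (p.1, p.2 - c p.1)) (P.prod Q) (P.prod Q) :=
  (MeasurePreserving.id P).skew_product (g := fun ω v => v - c ω)
    (measurable_snd.sub (hc.comp measurable_fst))
    (ae_of_all _ fun ω => (measurePreserving_sub_right Q (c ω)).map_eq)

lemma indep_comap_fst_skew {Ω : Type*} {m₁ m₂ mΩ : MeasurableSpace Ω} {P : Measure Ω}
    [IsProbabilityMeasure P] {Q : Measure UnitAddCircle} [IsProbabilityMeasure Q]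
    [Q.IsAddRightInvariant] {c : Ω → UnitAddCircle} (hc : Measurable c)
    (h₁ : m₁ ≤ mΩ) (h₂ : m₂ ≤ mΩ) (h : Indep m₁ m₂ P) :
    Indep (m₁.comap Prod.fst) (m₂.comap Prod.fst ⊔
      MeasurableSpace.comap (fun p : Ω × UnitAddCircle => p.2 - c p.1) inferInstance)
      (P.prod Q) := by
  have := Indep.comap_measurePreserving (measurePreserving_sub_skew P (Q := Q) hc)
    ((MeasurableSpace.comap_mono h₁).trans measurable_fst.comap_le)
    (sup_le ((MeasurableSpace.comap_mono h₂).trans measurable_fst.comap_le)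
      measurable_snd.comap_le) (indep_comap_fst_prod (Q := Q) h₁ h₂ h)
  simpa only [MeasurableSpace.comap_sup, MeasurableSpace.comap_comp, Function.comp_def] using this

end ProductIndependence

section TsirelsonSolution

variable {Ω : Type*} {T : ℝ} {t : ℤ → ℝ} {B : ℝ → Ω → ℝ}

/-- The normalized increment of `B` over `[t (k - 1), t k]`. -/
def gridSlope (t : ℤ → ℝ) (B : ℝ → Ω → ℝ) (k : ℤ) (ω : Ω) : ℝ :=
  (B (t k) ω - B (t (k - 1)) ω) / (t k - t (k - 1))

/-- The phase of the Tsirelson solution at time `t k`: the second coordinate is the phase at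
time `t 0`, and the phase turns by `gridSlope t B k` between `t (k - 1)` and `t k`. -/
def tsirelsonPhase (t : ℤ → ℝ) (B : ℝ → Ω → ℝ) (k : ℤ) (p : Ω × UnitAddCircle) :
    UnitAddCircle :=
  p.2 - ((∑ j ∈ Finset.Ioc k 0, gridSlope t B j p.1 : ℝ) : UnitAddCircle)

/-- The representative in `[0, 1)` of the phase. -/
def tsirelsonAngle (t : ℤ → ℝ) (B : ℝ → Ω → ℝ) (k : ℤ) (p : Ω × UnitAddCircle) : ℝ :=
  AddCircle.equivIco 1 0 (tsirelsonPhase t B k p)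

/-- The filtration generated by `B` and by the phases already reached. -/
def tsirelsonFilt (t : ℤ → ℝ) (B : ℝ → Ω → ℝ) (s : ℝ) : MeasurableSpace (Ω × UnitAddCircle) :=
  (natFilt B s).comap Prod.fst ⊔
    ⨆ k : ℤ, ⨆ _ : k ≤ 0 ∧ t k ≤ s, MeasurableSpace.comap (tsirelsonPhase t B k) inferInstance

lemma tsirelsonPhase_sub_one {k : ℤ} (hk : k ≤ 0) (p : Ω × UnitAddCircle) :
    tsirelsonPhase t B (k - 1) p =
      tsirelsonPhase t B k p - (gridSlope t B k p.1 : UnitAddCircle) := by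
  have : Finset.Ioc (k - 1) 0 = insert k (Finset.Ioc k 0) := by
    ext j
    simp only [Finset.mem_Ioc, Finset.mem_insert]
    omega
  rw [tsirelsonPhase, tsirelsonPhase, this, Finset.sum_insert (by simp), AddCircle.coe_add]
  abel

lemma tsirelsonAngle_mem_Icc (k : ℤ) (p : Ω × UnitAddCircle) :
    tsirelsonAngle t B k p ∈ Set.Icc (0 : ℝ) 1 := by
  have := (AddCircle.equivIco (1 : ℝ) 0 (tsirelsonPhase t B k p)).2
  exact ⟨this.1, (this.2.trans_eq (zero_add 1)).le⟩

lemma fract_gridSlope_add_tsirelsonAngle {k : ℤ} (hk : k ≤ 0) (p : Ω × UnitAddCircle) :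
    Int.fract (gridSlope t B k p.1 + tsirelsonAngle t B (k - 1) p) = tsirelsonAngle t B k p := by
  have h : ((gridSlope t B k p.1 + tsirelsonAngle t B (k - 1) p : ℝ) : UnitAddCircle) =
      tsirelsonPhase t B k p := by
    rw [AddCircle.coe_add, tsirelsonAngle, AddCircle.coe_equivIco, tsirelsonPhase_sub_one hk]
    abel
  rw [tsirelsonAngle.eq_def t B k p, ← h, AddCircle.coe_equivIco_mk_apply, div_one, mul_one]

lemma tsirelsonDrift_driftedProcess (ht : TsirelsonTimes T t) (s : ℝ) (p : Ω × UnitAddCircle) :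
    tsirelsonDrift t s
      (fun r => driftedProcess t (tsirelsonAngle t B) (fun u p => B u p.1) r p) =
      stepProcess t (tsirelsonAngle t B) s p := by
  by_cases h : ∃ k : ℤ, k ≤ -1 ∧ t k ≤ s ∧ s < t (k + 1)
  · obtain ⟨k, hk⟩ := h
    rw [tsirelsonDrift_eq_stepProcess s (fun p r =>
      driftedProcess t (tsirelsonAngle t B) (fun u p => B u p.1) r p), stepProcess_eq ht hk,
      stepProcess_eq ht hk, ← fract_gridSlope_add_tsirelsonAngle (by omega)]
    have hlt := ht.2.1 k (by omega)
    rw [driftedProcess_sub ht tsirelsonAngle_mem_Icc (k := k - 1) (by omega) hlt.le le_rfl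
      (by rw [sub_add_cancel]), gridSlope, add_comm, add_div,
      mul_div_cancel_left₀ _ (sub_pos.2 hlt).ne']
  · rw [tsirelsonDrift, stepProcess, dif_neg h, dif_neg h]

lemma natFilt_mono (B : ℝ → Ω → ℝ) {s u : ℝ} (h : s ≤ u) : natFilt B s ≤ natFilt B u :=
  iSup₂_le fun r hr => le_iSup₂_of_le r ⟨hr.1, hr.2.trans h⟩ le_rfl

lemma measurable_natFilt (B : ℝ → Ω → ℝ) {r s : ℝ} (hr : 0 ≤ r) (hrs : r ≤ s) :
    Measurable[natFilt B s] (B r) :=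
  (comap_measurable _).mono (le_iSup₂_of_le r ⟨hr, hrs⟩ le_rfl) le_rfl

lemma natFilt_le [mΩ : MeasurableSpace Ω] (hB : ∀ s, Measurable (B s)) (s : ℝ) :
    natFilt B s ≤ mΩ :=
  iSup₂_le fun r _ => (hB r).comap_le

lemma measurable_gridSlope [MeasurableSpace Ω] (hB : ∀ s, Measurable (B s)) (k : ℤ) :
    Measurable (gridSlope t B k) :=
  ((hB _).sub (hB _)).div_const _

lemma measurable_gridSlope_natFilt (ht : TsirelsonTimes T t) {k : ℤ} (hk : k ≤ 0) {s : ℝ}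
    (hs : t k ≤ s) : Measurable[natFilt B s] (gridSlope t B k) := by
  let _ := natFilt B s
  exact ((measurable_natFilt B (ht.pos hk).le hs).sub
    (measurable_natFilt B (ht.pos (by omega)).le ((ht.2.1 k hk).le.trans hs))).div_const _

lemma measurable_tsirelsonPhase [MeasurableSpace Ω] (hB : ∀ s, Measurable (B s)) (k : ℤ) :
    Measurable (tsirelsonPhase t B k) :=
  measurable_snd.sub (AddCircle.measurable_mk'.comp
    ((Finset.measurable_sum _ fun j _ => measurable_gridSlope hB j).comp measurable_fst))

lemma tsirelsonFilt_mono (t : ℤ → ℝ) (B : ℝ → Ω → ℝ) {s u : ℝ} (h : s ≤ u) :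
    tsirelsonFilt t B s ≤ tsirelsonFilt t B u :=
  sup_le_sup (MeasurableSpace.comap_mono (natFilt_mono B h))
    (iSup_mono fun _ => iSup_mono' fun hk => ⟨⟨hk.1, hk.2.trans h⟩, le_rfl⟩)

lemma tsirelsonFilt_le [MeasurableSpace Ω] (hB : ∀ s, Measurable (B s)) (s : ℝ) :
    tsirelsonFilt t B s ≤ Prod.instMeasurableSpace :=
  sup_le ((MeasurableSpace.comap_mono (natFilt_le hB s)).trans measurable_fst.comap_le)
    (iSup₂_le fun k _ => (measurable_tsirelsonPhase hB k).comap_le)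

lemma measurable_tsirelsonAngle {k : ℤ} (hk : k ≤ 0) {s : ℝ} (hs : t k ≤ s) :
    Measurable[tsirelsonFilt t B s] (tsirelsonAngle t B k) := by
  have h : Measurable[tsirelsonFilt t B s] (tsirelsonPhase t B k) :=
    (comap_measurable _).mono (le_sup_of_le_right (le_iSup₂_of_le k ⟨hk, hs⟩ le_rfl)) le_rfl
  have : Fact (0 < (1 : ℝ)) := ⟨one_pos⟩
  exact measurable_subtype_coe.comp ((AddCircle.measurableEquivIco 1 0).measurable.comp h)

/-- Up to time `s`, the phases are determined by `B` and the last phase reached. -/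
lemma tsirelsonFilt_le_last (ht : TsirelsonTimes T t) {s : ℝ} {k : ℤ} (hk : k ≤ 0)
    (hks : t k ≤ s) (hlast : ∀ j ≤ 0, t j ≤ s → j ≤ k) :
    tsirelsonFilt t B s ≤ (natFilt B s).comap Prod.fst ⊔
      MeasurableSpace.comap (tsirelsonPhase t B k) inferInstance := by
  refine sup_le le_sup_left (iSup₂_le fun j hj => ?_)
  rw [← measurable_iff_comap_le]
  induction j, hlast j hj.1 hj.2 using Int.leInductionDown with
  | base => exact (comap_measurable _).mono le_sup_right le_rfl
  | pred j hjk ih =>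
    have hjs : t j ≤ s := (ht.strictMonoOn.monotoneOn (show j ≤ 0 by omega) hk hjk).trans hks
    have hslope : Measurable[(natFilt B s).comap Prod.fst ⊔
        MeasurableSpace.comap (tsirelsonPhase t B k) inferInstance]
        fun p : Ω × UnitAddCircle => (gridSlope t B j p.1 : UnitAddCircle) :=
      AddCircle.measurable_mk'.comp ((measurable_gridSlope_natFilt ht (by omega) hjs).comp
        ((comap_measurable _).mono le_sup_left le_rfl))
    rw [show tsirelsonPhase t B (j - 1) = fun p => tsirelsonPhase t B j p -
      (gridSlope t B j p.1 : UnitAddCircle) from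
      funext fun p => tsirelsonPhase_sub_one (by omega) p]
    exact (ih ⟨by omega, hjs⟩).sub hslope

lemma isBM_tsirelsonFilt (ht : TsirelsonTimes T t) [mΩ : MeasurableSpace Ω] {P : Measure Ω}
    [IsProbabilityMeasure P] {Q : Measure UnitAddCircle} [IsProbabilityMeasure Q]
    [Q.IsAddRightInvariant] (hm : ∀ s, Measurable (B s)) (hB : IsBM P (natFilt B) B) :
    IsBM (P.prod Q) (tsirelsonFilt t B) fun s p => B s p.1 := by
  refine ⟨fun p => hB.1 p.1, fun p => hB.2.1 p.1, fun s hs => ?_, fun s u hs hsu => ⟨?_, ?_⟩⟩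
  · exact (measurable_natFilt B hs le_rfl).comp ((comap_measurable _).mono le_sup_left le_rfl)
  · have h := (Measure.map_map (μ := P.prod Q) ((hm u).sub (hm s)) measurable_fst).symm
    rw [measurePreserving_fst.map_eq] at h
    exact h.trans (hB.2.2.2 s u hs hsu).1
  · have hind := (hB.2.2.2 s u hs hsu).2
    have hle : MeasurableSpace.comap (fun ω => B u ω - B s ω) inferInstance ≤ mΩ :=
      ((hm u).sub (hm s)).comap_le
    have hcomap : MeasurableSpace.comap (fun p : Ω × UnitAddCircle => B u p.1 - B s p.1)
        inferInstance =
        (MeasurableSpace.comap (fun ω => B u ω - B s ω) inferInstance).comap Prod.fst := by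
      rw [MeasurableSpace.comap_comp]
      rfl
    rw [hcomap]
    rcases hs.eq_or_lt with rfl | hs
    · refine indep_of_indep_of_le_right
        (indep_comap_fst_prod hle (natFilt_le hm 0) hind) (sup_le le_sup_left ?_)
      exact iSup₂_le fun k hk => absurd hk.2 (ht.pos hk.1).not_ge
    · obtain ⟨k, hk, hks, hlast⟩ := ht.exists_last_le hs
      exact indep_of_indep_of_le_right
        (indep_comap_fst_skew (AddCircle.measurable_mk'.comp
          (Finset.measurable_sum _ fun j _ => measurable_gridSlope hm j))
          hle (natFilt_le hm s) hind)
        (tsirelsonFilt_le_last ht hk hks hlast)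

lemma progMeas_tsirelsonDrift (ht : TsirelsonTimes T t) [MeasurableSpace Ω] (P : Measure Ω)
    (X : ℝ → Ω → ℝ) :
    ProgMeas (augFilt P X) fun s ω => tsirelsonDrift t s (fun r => X r ω) := by
  refine progMeas_stepProcess ht (θ := fun k ω =>
    Int.fract (gridSlope t X k ω)) fun s k hk hks => ?_
  exact (measurable_fract.comp (measurable_gridSlope_natFilt ht (by omega) hks)).mono
    le_sup_left le_rfl

/-- A weak solution of Tsirelson's equation, started from an independent uniform phase. -/
theorem exists_tsirelson_solution (ht : TsirelsonTimes T t) :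
    ∃ S : ControlWeakSol T, S.ClosedLoop ∧
      (∀ s ω, S.α s ω = tsirelsonDrift t s (fun u => S.X u ω)) ∧
      S.P {ω | ((fun s => S.B s ω), (fun s => S.X s ω)) ∈ tsirelsonSetD T t} = 1 := by
  obtain ⟨Ω, mΩ, P, B, hP, hm, hB⟩ := exists_isBM
  have hQ : IsProbabilityMeasure (volume : Measure UnitAddCircle) :=
    ⟨UnitAddCircle.measure_univ⟩
  have hBM := isBM_tsirelsonFilt (Q := volume) ht hm hB
  have hstep : ProgMeas (tsirelsonFilt t B) (stepProcess t (tsirelsonAngle t B)) :=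
    progMeas_stepProcess ht fun s k hk hks => measurable_tsirelsonAngle (by omega) hks
  let S : ControlWeakSol T :=
    { Ω := Ω × UnitAddCircle
      mΩ := inferInstance
      P := P.prod volume
      hP := inferInstance
      F := tsirelsonFilt t B
      F_mono := fun _ _ => tsirelsonFilt_mono t B
      F_le := tsirelsonFilt_le hm
      B := fun s p => B s p.1
      X := driftedProcess t (tsirelsonAngle t B) fun s p => B s p.1
      α := stepProcess t (tsirelsonAngle t B)
      hB := hBM
      α_prog := hstep
      α_mem := stepProcess_mem_Icc tsirelsonAngle_mem_Icc
      X_cont := continuous_driftedProcess ht tsirelsonAngle_mem_Icc hBM.2.1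
      X_prog := progMeas_driftedProcess ht tsirelsonAngle_mem_Icc
        (fun _ _ => tsirelsonFilt_mono t B) hstep hBM.2.2.1 hBM.2.1
      sde := ae_of_all _ fun p s hs => driftedProcess_eq_setIntegral hs.1 p }
  have hα (s : ℝ) (p : S.Ω) : S.α s p = tsirelsonDrift t s (fun u => S.X u p) :=
    (tsirelsonDrift_driftedProcess ht s p).symm
  refine ⟨S, ?_, hα, ?_⟩
  · have := progMeas_tsirelsonDrift ht S.P S.X
    simp_rw [← hα] at this
    exact this
  · have := S.hP
    convert measure_univ (μ := S.P)
    exact Set.eq_univ_of_forall fun p => mem_tsirelsonSetD_driftedProcess ht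
      tsirelsonAngle_mem_Icc fun s => tsirelsonDrift_driftedProcess ht s p

end TsirelsonSolution

lemma ControlWeakSol.payoff_le_one {T : ℝ} (t : ℤ → ℝ) (S : ControlWeakSol T) :
    S.payoff t ≤ 1 := by
  have := S.hP
  exact measureReal_le_one

/-- There is a closed-loop weak solution, namely the weak solution of
Tsirelson's SDE with `α_s := μ(s, X)`, for which `(B, X) ∈ D` a.s.; consequently
`V^c_0 = 1`. -/
theorem closed_loop_value_eq_one
    (T : ℝ) (hT : 0 < T) (t : ℤ → ℝ) (ht : TsirelsonTimes T t) :
    (∃ S : ControlWeakSol T, S.ClosedLoop ∧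
      (∀ s ω, S.α s ω = tsirelsonDrift t s (fun u => S.X u ω)) ∧
      S.P {ω | ((fun s => S.B s ω), (fun s => S.X s ω)) ∈ tsirelsonSetD T t} = 1) ∧
    VclosedD T t = 1 := by
  obtain ⟨S, hS, hα, hD⟩ := exists_tsirelson_solution ht
  refine ⟨⟨S, hS, hα, hD⟩, ?_⟩
  have hmem : (1 : ℝ) ∈ {r | ∃ S : ControlWeakSol T, S.ClosedLoop ∧ r = S.payoff t} :=
    ⟨S, hS, by rw [ControlWeakSol.payoff, hD, ENNReal.toReal_one]⟩
  have hub : ∀ r ∈ {r | ∃ S : ControlWeakSol T, S.ClosedLoop ∧ r = S.payoff t}, r ≤ 1 := by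
    rintro _ ⟨S', -, rfl⟩
    exact S'.payoff_le_one t
  exact le_antisymm (csSup_le ⟨1, hmem⟩ hub) (le_csSup ⟨1, hub⟩ hmem)

end
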